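/- arXiv:2310.14375 — 2 statements merged into one kernel-verified Lean document; each statement's English description precedes it below -/
import Mathlib

section
/- Let M, a be reals with 0 ≤ a < M, let g be the Kerr metric in Boyer–Lindquist coordinates on U = {(t,r,θ,φ) ∈ ℝ⁴ : r > M + √(M²−a²), 0 < θ < π}, and let (e₀,e₁,e₂,e₃) be the canonical tetrad. Then on U: g(∇_{e₀}e₀, e₃) = −a²cosθ sinθ/(ρ²√ρ²); g(∇_{e₀}e₀, e₂) = (a²cos²θ(r−M) + r(Mr−a²))/(ρ²√(ρ²Δ)); g(∇_{e₁}e₁, e₃) = −cosθ(r²+a²)/(ρ²√ρ² sinθ); g(∇_{e₁}e₁, e₂) = −(r/ρ²)√(Δ/ρ²); g(∇_{e₂}e₂, e₁) = g(∇_{e₃}e₃, e₁) = 0; and g(∇_{e₂}e₂, e₀) = g(∇_{e₃}e₃, e₀) = 0. -/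
noncomputable section

set_option linter.unusedSimpArgs false

/-- Partial derivative of `f` in the coordinate direction `μ`,
coordinates `(x 0, x 1, x 2, x 3) = (t, r, θ, φ)`. -/
def pd (μ : Fin 4) (f : (Fin 4 → ℝ) → ℝ) (x : Fin 4 → ℝ) : ℝ :=
  fderiv ℝ f x (Pi.single μ 1)

/-- ρ² = r² + a² cos²θ. -/
def rho2 (a : ℝ) (x : Fin 4 → ℝ) : ℝ := (x 1) ^ 2 + a ^ 2 * Real.cos (x 2) ^ 2

/-- Δ = r² − 2Mr + a². -/
def Del (M a : ℝ) (x : Fin 4 → ℝ) : ℝ := (x 1) ^ 2 - 2 * M * (x 1) + a ^ 2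

/-- Σ² = (r²+a²)² − Δ a² sin²θ. -/
def Sig2 (M a : ℝ) (x : Fin 4 → ℝ) : ℝ :=
  ((x 1) ^ 2 + a ^ 2) ^ 2 - Del M a x * a ^ 2 * Real.sin (x 2) ^ 2

/-- The Kerr metric in Boyer–Lindquist coordinates `(t, r, θ, φ)`. -/
def kerr (M a : ℝ) (x : Fin 4 → ℝ) : Matrix (Fin 4) (Fin 4) ℝ :=
  Matrix.of fun μ ν =>
    if μ = 0 ∧ ν = 0 then -1 + 2 * M * (x 1) / rho2 a x
    else if (μ = 0 ∧ ν = 3) ∨ (μ = 3 ∧ ν = 0) then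
      -(2 * M * (x 1) * a * Real.sin (x 2) ^ 2) / rho2 a x
    else if μ = 1 ∧ ν = 1 then rho2 a x / Del M a x
    else if μ = 2 ∧ ν = 2 then rho2 a x
    else if μ = 3 ∧ ν = 3 then Sig2 M a x * Real.sin (x 2) ^ 2 / rho2 a x
    else 0

/-- The exterior Kerr domain U = {r > r₊, 0 < θ < π}. -/
def KerrExt (M a : ℝ) : Set (Fin 4 → ℝ) :=
  {x | M + Real.sqrt (M ^ 2 - a ^ 2) < x 1 ∧ 0 < x 2 ∧ x 2 < Real.pi}

/-- The canonical tetrad (e₀, e₁, e₂, e₃) in exterior Kerr geometry. -/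
def tetrad (M a : ℝ) : Fin 4 → (Fin 4 → ℝ) → Fin 4 → ℝ :=
  ![fun x μ => (Real.sqrt (rho2 a x * Del M a x))⁻¹ * ![(x 1) ^ 2 + a ^ 2, 0, 0, a] μ,
    fun x μ => (Real.sqrt (rho2 a x) * Real.sin (x 2))⁻¹ *
      ![a * Real.sin (x 2) ^ 2, 0, 0, 1] μ,
    fun x μ => Real.sqrt (Del M a x / rho2 a x) * ![0, 1, 0, 0] μ,
    fun x μ => (Real.sqrt (rho2 a x))⁻¹ * ![0, 0, 1, 0] μ]

/-- Christoffel symbols Γ^λ_{μν} of the Kerr metric. -/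
def chr (M a : ℝ) (lam μ ν : Fin 4) (x : Fin 4 → ℝ) : ℝ :=
  (1 / 2) * ∑ σ : Fin 4, (kerr M a x)⁻¹ lam σ *
    (pd μ (fun y => kerr M a y ν σ) x + pd ν (fun y => kerr M a y μ σ) x
      - pd σ (fun y => kerr M a y μ ν) x)

/-- Covariant derivative (∇_v w)^λ = v^μ ∂_μ w^λ + Γ^λ_{μν} v^μ w^ν. -/
def nab (M a : ℝ) (v w : (Fin 4 → ℝ) → Fin 4 → ℝ) (x : Fin 4 → ℝ) (lam : Fin 4) : ℝ :=
  (∑ μ : Fin 4, v x μ * pd μ (fun y => w y lam) x)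
    + ∑ μ : Fin 4, ∑ ν : Fin 4, chr M a lam μ ν x * v x μ * w x ν

/-- g(v, w) = g_{μν} v^μ w^ν. -/
def gdot (M a : ℝ) (v w : (Fin 4 → ℝ) → Fin 4 → ℝ) (x : Fin 4 → ℝ) : ℝ :=
  ∑ μ : Fin 4, ∑ ν : Fin 4, kerr M a x μ ν * v x μ * w x ν


/-- Metric entries. -/
def kA (M a : ℝ) (x : Fin 4 → ℝ) : ℝ := -1 + 2 * M * (x 1) / rho2 a x
def kB (M a : ℝ) (x : Fin 4 → ℝ) : ℝ := -(2 * M * (x 1) * a * Real.sin (x 2) ^ 2) / rho2 a x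
def kC (M a : ℝ) (x : Fin 4 → ℝ) : ℝ := rho2 a x / Del M a x
def kE (M a : ℝ) (x : Fin 4 → ℝ) : ℝ := Sig2 M a x * Real.sin (x 2) ^ 2 / rho2 a x

lemma kerr_eq (M a : ℝ) (x : Fin 4 → ℝ) : kerr M a x =
    !![kA M a x, 0, 0, kB M a x; 0, kC M a x, 0, 0; 0, 0, rho2 a x, 0;
      kB M a x, 0, 0, kE M a x] := by
  ext i j
  fin_cases i <;> fin_cases j <;> simp [kerr, kA, kB, kC, kE]

lemma kerr_pos (M a : ℝ) (ha : 0 ≤ a) (haM : a < M) (x : Fin 4 → ℝ) (hx : x ∈ KerrExt M a) :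
    0 < x 1 ∧ 0 < Real.sin (x 2) ∧ 0 < Del M a x ∧ 0 < rho2 a x := by
  obtain ⟨h1, h2, h3⟩ := hx
  have hs := Real.sqrt_nonneg (M ^ 2 - a ^ 2)
  have hs2 : Real.sqrt (M ^ 2 - a ^ 2) ^ 2 = M ^ 2 - a ^ 2 := Real.sq_sqrt (by nlinarith)
  have hr : 0 < x 1 := by linarith
  refine ⟨hr, Real.sin_pos_of_pos_of_lt_pi h2 h3, ?_, ?_⟩
  · unfold Del; nlinarith
  · unfold rho2; positivity

lemma kerr_det (M a : ℝ) (x : Fin 4 → ℝ) (hρ : rho2 a x ≠ 0) :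
    kA M a x * kE M a x - kB M a x ^ 2 = - (Del M a x * Real.sin (x 2) ^ 2) := by
  unfold kA kB kE
  have hs : Real.sin (x 2) ^ 2 = 1 - Real.cos (x 2) ^ 2 := Real.sin_sq _
  field_simp
  unfold Sig2 Del rho2
  rw [hs]
  ring

lemma kerr_inv (M a : ℝ) (x : Fin 4 → ℝ) (hS : Real.sin (x 2) ≠ 0) (hD : Del M a x ≠ 0)
    (hρ : rho2 a x ≠ 0) : (!![kA M a x, 0, 0, kB M a x; 0, kC M a x, 0, 0; 0, 0, rho2 a x, 0;
      kB M a x, 0, 0, kE M a x] : Matrix (Fin 4) (Fin 4) ℝ)⁻¹ =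
    !![kE M a x / (kA M a x * kE M a x - kB M a x ^ 2), 0, 0,
        -kB M a x / (kA M a x * kE M a x - kB M a x ^ 2);
      0, (kC M a x)⁻¹, 0, 0; 0, 0, (rho2 a x)⁻¹, 0;
      -kB M a x / (kA M a x * kE M a x - kB M a x ^ 2), 0, 0,
        kA M a x / (kA M a x * kE M a x - kB M a x ^ 2)] := by
  have hd : kA M a x * kE M a x - kB M a x ^ 2 ≠ 0 := by
    rw [kerr_det M a x hρ]; simp [hS, hD]
  have hC : kC M a x ≠ 0 := by unfold kC; exact div_ne_zero hρ hD
  apply Matrix.inv_eq_right_inv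
  generalize hdd : kA M a x * kE M a x - kB M a x ^ 2 = d at *
  ext i j
  fin_cases i <;> fin_cases j <;>
    simp [Matrix.mul_apply, Fin.sum_univ_four, hC, hρ] <;> field_simp <;> linarith

lemma pd_eq {μ : Fin 4} {f : (Fin 4 → ℝ) → ℝ} {x : Fin 4 → ℝ} {d : ℝ}
    (hf : DifferentiableAt ℝ f x)
    (hd : HasDerivAt (fun s : ℝ => f (Function.update x μ s)) d (x μ)) : pd μ f x = d := by
  have h1 : HasDerivAt (fun s : ℝ => Function.update x μ s) (Pi.single μ 1) (x μ) :=
    hasDerivAt_update x μ (x μ)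
  have h2 : HasFDerivAt f (fderiv ℝ f x) (Function.update x μ (x μ)) := by
    simpa using hf.hasFDerivAt
  exact (h2.comp_hasDerivAt (x μ) h1).unique hd

lemma pd_zero_of {μ : Fin 4} {f : (Fin 4 → ℝ) → ℝ} {x : Fin 4 → ℝ}
    (h : ∀ s, f (Function.update x μ s) = f x) : pd μ f x = 0 := by
  by_cases hf : DifferentiableAt ℝ f x
  · apply pd_eq hf
    simp only [h]
    exact hasDerivAt_const _ _
  · simp [pd, fderiv_zero_of_not_differentiableAt hf]

lemma pd_const' (μ : Fin 4) (c : ℝ) (x : Fin 4 → ℝ) : pd μ (fun _ => c) x = 0 :=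
  pd_zero_of fun _ => rfl

lemma pd_kA0 (M a : ℝ) (x : Fin 4 → ℝ) : pd 0 (fun y => kA M a y) x = 0 :=
  pd_zero_of fun s => by simp [kA, kB, kC, kE, rho2, Del, Sig2]

lemma pd_kA3 (M a : ℝ) (x : Fin 4 → ℝ) : pd 3 (fun y => kA M a y) x = 0 :=
  pd_zero_of fun s => by simp [kA, kB, kC, kE, rho2, Del, Sig2]

lemma pd_kB0 (M a : ℝ) (x : Fin 4 → ℝ) : pd 0 (fun y => kB M a y) x = 0 :=
  pd_zero_of fun s => by simp [kA, kB, kC, kE, rho2, Del, Sig2]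

lemma pd_kB3 (M a : ℝ) (x : Fin 4 → ℝ) : pd 3 (fun y => kB M a y) x = 0 :=
  pd_zero_of fun s => by simp [kA, kB, kC, kE, rho2, Del, Sig2]

lemma pd_kC0 (M a : ℝ) (x : Fin 4 → ℝ) : pd 0 (fun y => kC M a y) x = 0 :=
  pd_zero_of fun s => by simp [kA, kB, kC, kE, rho2, Del, Sig2]

lemma pd_kC3 (M a : ℝ) (x : Fin 4 → ℝ) : pd 3 (fun y => kC M a y) x = 0 :=
  pd_zero_of fun s => by simp [kA, kB, kC, kE, rho2, Del, Sig2]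

lemma pd_kE0 (M a : ℝ) (x : Fin 4 → ℝ) : pd 0 (fun y => kE M a y) x = 0 :=
  pd_zero_of fun s => by simp [kA, kB, kC, kE, rho2, Del, Sig2]

lemma pd_kE3 (M a : ℝ) (x : Fin 4 → ℝ) : pd 3 (fun y => kE M a y) x = 0 :=
  pd_zero_of fun s => by simp [kA, kB, kC, kE, rho2, Del, Sig2]

lemma pd_rho0 (a : ℝ) (x : Fin 4 → ℝ) : pd 0 (fun y => rho2 a y) x = 0 :=
  pd_zero_of fun s => by simp [kA, kB, kC, kE, rho2, Del, Sig2]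

lemma pd_rho3 (a : ℝ) (x : Fin 4 → ℝ) : pd 3 (fun y => rho2 a y) x = 0 :=
  pd_zero_of fun s => by simp [kA, kB, kC, kE, rho2, Del, Sig2]

lemma rho_d1 (a : ℝ) (x : Fin 4 → ℝ) :
    HasDerivAt (fun s : ℝ => s ^ 2 + a ^ 2 * Real.cos (x 2) ^ 2) (2 * x 1) (x 1) := by
  simpa using ((hasDerivAt_id (x 1)).pow 2).add_const (a ^ 2 * Real.cos (x 2) ^ 2)

lemma rho_d2 (a : ℝ) (x : Fin 4 → ℝ) :
    HasDerivAt (fun s : ℝ => x 1 ^ 2 + a ^ 2 * Real.cos s ^ 2)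
      (-(2 * a ^ 2 * Real.cos (x 2) * Real.sin (x 2))) (x 2) := by
  have := (((Real.hasDerivAt_cos (x 2)).pow 2).const_mul (a ^ 2)).const_add (x 1 ^ 2)
  exact this.congr_deriv (by
    try simp only [Del, id, show (2 : ℕ) - 1 = 1 from rfl, Pi.pow_apply, Pi.sub_apply,
      Pi.add_apply, Pi.mul_apply]
    try push_cast
    try ring)

lemma diff_rho (a : ℝ) (x : Fin 4 → ℝ) : DifferentiableAt ℝ (fun y => rho2 a y) x := by
  unfold rho2; fun_prop

lemma diff_kA (M a : ℝ) (x : Fin 4 → ℝ) (hρ : rho2 a x ≠ 0) :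
    DifferentiableAt ℝ (fun y => kA M a y) x := by
  unfold kA
  have := diff_rho a x
  fun_prop (disch := assumption)

lemma pd_kA1 (M a : ℝ) (x : Fin 4 → ℝ) (hρ : rho2 a x ≠ 0) :
    pd 1 (fun y => kA M a y) x =
      (2 * M * rho2 a x - 2 * M * x 1 * 2 * x 1) / rho2 a x ^ 2 := by
  apply pd_eq (diff_kA M a x hρ)
  have hN : HasDerivAt (fun s : ℝ => 2 * M * s)
      (2 * M) (x 1) := by
    have := HasDerivAt.const_mul (2 * M) (hasDerivAt_id (x 1))
    exact this.congr_deriv (by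
      try simp only [Del, id, show (2 : ℕ) - 1 = 1 from rfl, Pi.pow_apply, Pi.sub_apply,
        Pi.add_apply, Pi.mul_apply]
      try push_cast
      try ring)
  have := (hN.div (rho_d1 a x) hρ).const_add (-1)
  have hfun : (fun s : ℝ => kA M a (Function.update x 1 s)) = fun s =>
      -1 + (2 * M * s) / (s ^ 2 + a ^ 2 * Real.cos (x 2) ^ 2) := by
    funext s
    simp [kA, rho2, Sig2, Del]
  rw [hfun]
  exact this.congr_deriv (by simp only [rho2, Sig2, Del]; try ring)

lemma pd_kA2 (M a : ℝ) (x : Fin 4 → ℝ) (hρ : rho2 a x ≠ 0) :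
    pd 2 (fun y => kA M a y) x =
      (0 * rho2 a x - 2 * M * x 1 * (-(2 * a ^ 2 * Real.cos (x 2) * Real.sin (x 2)))) / rho2 a x ^ 2 := by
  apply pd_eq (diff_kA M a x hρ)
  have hN : HasDerivAt (fun s : ℝ => 2 * M * x 1)
      0 (x 2) := by
    have := hasDerivAt_const (x 2) (2 * M * x 1)
    exact this.congr_deriv (by
      try simp only [Del, id, show (2 : ℕ) - 1 = 1 from rfl, Pi.pow_apply, Pi.sub_apply,
        Pi.add_apply, Pi.mul_apply]
      try push_cast
      try ring)
  have := (hN.div (rho_d2 a x) hρ).const_add (-1)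
  have hfun : (fun s : ℝ => kA M a (Function.update x 2 s)) = fun s =>
      -1 + (2 * M * x 1) / (x 1 ^ 2 + a ^ 2 * Real.cos s ^ 2) := by
    funext s
    simp [kA, rho2, Sig2, Del]
  rw [hfun]
  exact this.congr_deriv (by simp only [rho2, Sig2, Del]; try ring)

lemma diff_kB (M a : ℝ) (x : Fin 4 → ℝ) (hρ : rho2 a x ≠ 0) :
    DifferentiableAt ℝ (fun y => kB M a y) x := by
  unfold kB
  have := diff_rho a x
  fun_prop (disch := assumption)

lemma pd_kB1 (M a : ℝ) (x : Fin 4 → ℝ) (hρ : rho2 a x ≠ 0) :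
    pd 1 (fun y => kB M a y) x =
      ((-(2 * M * a * Real.sin (x 2) ^ 2)) * rho2 a x - (-(2 * M * x 1 * a * Real.sin (x 2) ^ 2)) * 2 * x 1) / rho2 a x ^ 2 := by
  apply pd_eq (diff_kB M a x hρ)
  have hN : HasDerivAt (fun s : ℝ => -(2 * M * s * a * Real.sin (x 2) ^ 2))
      (-(2 * M * a * Real.sin (x 2) ^ 2)) (x 1) := by
    have := ((((hasDerivAt_id (x 1)).const_mul (2 * M)).mul_const a).mul_const (Real.sin (x 2) ^ 2)).neg
    exact this.congr_deriv (by
      try simp only [Del, id, show (2 : ℕ) - 1 = 1 from rfl, Pi.pow_apply, Pi.sub_apply,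
        Pi.add_apply, Pi.mul_apply]
      try push_cast
      try ring)
  have := hN.div (rho_d1 a x) hρ
  have hfun : (fun s : ℝ => kB M a (Function.update x 1 s)) = fun s =>
      (-(2 * M * s * a * Real.sin (x 2) ^ 2)) / (s ^ 2 + a ^ 2 * Real.cos (x 2) ^ 2) := by
    funext s
    simp [kB, rho2, Sig2, Del]
  rw [hfun]
  exact this.congr_deriv (by simp only [rho2, Sig2, Del]; try ring)

lemma pd_kB2 (M a : ℝ) (x : Fin 4 → ℝ) (hρ : rho2 a x ≠ 0) :
    pd 2 (fun y => kB M a y) x =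
      ((-(4 * M * x 1 * a * Real.sin (x 2) * Real.cos (x 2))) * rho2 a x - (-(2 * M * x 1 * a * Real.sin (x 2) ^ 2)) * (-(2 * a ^ 2 * Real.cos (x 2) * Real.sin (x 2)))) / rho2 a x ^ 2 := by
  apply pd_eq (diff_kB M a x hρ)
  have hN : HasDerivAt (fun s : ℝ => -(2 * M * x 1 * a * Real.sin s ^ 2))
      (-(4 * M * x 1 * a * Real.sin (x 2) * Real.cos (x 2))) (x 2) := by
    have := (((Real.hasDerivAt_sin (x 2)).pow 2).const_mul (2 * M * x 1 * a)).neg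
    exact this.congr_deriv (by
      try simp only [Del, id, show (2 : ℕ) - 1 = 1 from rfl, Pi.pow_apply, Pi.sub_apply,
        Pi.add_apply, Pi.mul_apply]
      try push_cast
      try ring)
  have := hN.div (rho_d2 a x) hρ
  have hfun : (fun s : ℝ => kB M a (Function.update x 2 s)) = fun s =>
      (-(2 * M * x 1 * a * Real.sin s ^ 2)) / (x 1 ^ 2 + a ^ 2 * Real.cos s ^ 2) := by
    funext s
    simp [kB, rho2, Sig2, Del]
  rw [hfun]
  exact this.congr_deriv (by simp only [rho2, Sig2, Del]; try ring)

lemma diff_kE (M a : ℝ) (x : Fin 4 → ℝ) (hρ : rho2 a x ≠ 0) :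
    DifferentiableAt ℝ (fun y => kE M a y) x := by
  unfold kE
  have := diff_rho a x
  unfold Sig2 Del
  fun_prop (disch := assumption)

lemma pd_kE1 (M a : ℝ) (x : Fin 4 → ℝ) (hρ : rho2 a x ≠ 0) :
    pd 1 (fun y => kE M a y) x =
      (((4 * x 1 * (x 1 ^ 2 + a ^ 2) - (2 * x 1 - 2 * M) * a ^ 2 * Real.sin (x 2) ^ 2) * Real.sin (x 2) ^ 2) * rho2 a x - (Sig2 M a x * Real.sin (x 2) ^ 2) * 2 * x 1) / rho2 a x ^ 2 := by
  apply pd_eq (diff_kE M a x hρ)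
  have hN : HasDerivAt (fun s : ℝ => ((s ^ 2 + a ^ 2) ^ 2 - (s ^ 2 - 2 * M * s + a ^ 2) * a ^ 2 * Real.sin (x 2) ^ 2) * Real.sin (x 2) ^ 2)
      ((4 * x 1 * (x 1 ^ 2 + a ^ 2) - (2 * x 1 - 2 * M) * a ^ 2 * Real.sin (x 2) ^ 2) * Real.sin (x 2) ^ 2) (x 1) := by
    have := (((((hasDerivAt_id (x 1)).pow 2).add_const (a ^ 2)).pow 2).sub ((((((hasDerivAt_id (x 1)).pow 2).sub ((hasDerivAt_id (x 1)).const_mul (2 * M))).add_const (a ^ 2)).mul_const (a ^ 2)).mul_const (Real.sin (x 2) ^ 2))).mul_const (Real.sin (x 2) ^ 2)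
    exact this.congr_deriv (by
      try simp only [Del, id, show (2 : ℕ) - 1 = 1 from rfl, Pi.pow_apply, Pi.sub_apply,
        Pi.add_apply, Pi.mul_apply]
      try push_cast
      try ring)
  have := hN.div (rho_d1 a x) hρ
  have hfun : (fun s : ℝ => kE M a (Function.update x 1 s)) = fun s =>
      (((s ^ 2 + a ^ 2) ^ 2 - (s ^ 2 - 2 * M * s + a ^ 2) * a ^ 2 * Real.sin (x 2) ^ 2) * Real.sin (x 2) ^ 2) / (s ^ 2 + a ^ 2 * Real.cos (x 2) ^ 2) := by
    funext s
    simp [kE, rho2, Sig2, Del]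
  rw [hfun]
  exact this.congr_deriv (by simp only [rho2, Sig2, Del]; try ring)

lemma pd_kE2 (M a : ℝ) (x : Fin 4 → ℝ) (hρ : rho2 a x ≠ 0) :
    pd 2 (fun y => kE M a y) x =
      ((2 * (x 1 ^ 2 + a ^ 2) ^ 2 * Real.sin (x 2) * Real.cos (x 2) - 4 * Del M a x * a ^ 2 * Real.sin (x 2) ^ 3 * Real.cos (x 2)) * rho2 a x - (Sig2 M a x * Real.sin (x 2) ^ 2) * (-(2 * a ^ 2 * Real.cos (x 2) * Real.sin (x 2)))) / rho2 a x ^ 2 := by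
  apply pd_eq (diff_kE M a x hρ)
  have hN : HasDerivAt (fun s : ℝ => ((x 1 ^ 2 + a ^ 2) ^ 2 - (x 1 ^ 2 - 2 * M * x 1 + a ^ 2) * a ^ 2 * Real.sin s ^ 2) * Real.sin s ^ 2)
      (2 * (x 1 ^ 2 + a ^ 2) ^ 2 * Real.sin (x 2) * Real.cos (x 2) - 4 * Del M a x * a ^ 2 * Real.sin (x 2) ^ 3 * Real.cos (x 2)) (x 2) := by
    have := ((((Real.hasDerivAt_sin (x 2)).pow 2).const_mul ((x 1 ^ 2 - 2 * M * x 1 + a ^ 2) * a ^ 2)).const_sub ((x 1 ^ 2 + a ^ 2) ^ 2)).mul ((Real.hasDerivAt_sin (x 2)).pow 2)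
    exact this.congr_deriv (by
      try simp only [Del, id, show (2 : ℕ) - 1 = 1 from rfl, Pi.pow_apply, Pi.sub_apply,
        Pi.add_apply, Pi.mul_apply]
      try push_cast
      try ring)
  have := hN.div (rho_d2 a x) hρ
  have hfun : (fun s : ℝ => kE M a (Function.update x 2 s)) = fun s =>
      (((x 1 ^ 2 + a ^ 2) ^ 2 - (x 1 ^ 2 - 2 * M * x 1 + a ^ 2) * a ^ 2 * Real.sin s ^ 2) * Real.sin s ^ 2) / (x 1 ^ 2 + a ^ 2 * Real.cos s ^ 2) := by
    funext s
    simp [kE, rho2, Sig2, Del]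
  rw [hfun]
  exact this.congr_deriv (by simp only [rho2, Sig2, Del]; try ring)

/-- Contraction of a quadratic form in the derivatives of the metric. -/
lemma alg (C u ρ NA NB NE k R0 R3 w0 w3 K : ℝ) (hC : C ≠ 0) (hw0 : w0 = k * R0)
    (hw3 : w3 = k * R3) (key : NA * R0 ^ 2 + 2 * NB * R0 * R3 + NE * R3 ^ 2 = K) :
    C * (-(2⁻¹ * (C⁻¹ * (NA / ρ ^ 2)) * w0 * w0) + -(2⁻¹ * (C⁻¹ * (NB / ρ ^ 2)) * w0 * w3) +
      (-(2⁻¹ * (C⁻¹ * (NB / ρ ^ 2)) * w3 * w0) + -(2⁻¹ * (C⁻¹ * (NE / ρ ^ 2)) * w3 * w3))) * u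
      = -(1 / 2) * u * k ^ 2 * K / ρ ^ 2 := by
  subst hw0 hw3
  rw [← key]
  field_simp
  ring

set_option maxHeartbeats 4000000 in
/-- the connection coefficients of the canonical tetrad in Kerr. -/
theorem kerr_tetrad_connection (M a : ℝ) (ha : 0 ≤ a) (haM : a < M) :
    ∀ x ∈ KerrExt M a,
      gdot M a (nab M a (tetrad M a 0) (tetrad M a 0)) (tetrad M a 3) x
        = -(a ^ 2 * Real.cos (x 2) * Real.sin (x 2)) / (rho2 a x * Real.sqrt (rho2 a x)) ∧
      gdot M a (nab M a (tetrad M a 0) (tetrad M a 0)) (tetrad M a 2) x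
        = (a ^ 2 * Real.cos (x 2) ^ 2 * ((x 1) - M) + (x 1) * (M * (x 1) - a ^ 2))
            / (rho2 a x * Real.sqrt (rho2 a x * Del M a x)) ∧
      gdot M a (nab M a (tetrad M a 1) (tetrad M a 1)) (tetrad M a 3) x
        = -(Real.cos (x 2) * ((x 1) ^ 2 + a ^ 2))
            / (rho2 a x * Real.sqrt (rho2 a x) * Real.sin (x 2)) ∧
      gdot M a (nab M a (tetrad M a 1) (tetrad M a 1)) (tetrad M a 2) x
        = -((x 1) / rho2 a x) * Real.sqrt (Del M a x / rho2 a x) ∧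
      gdot M a (nab M a (tetrad M a 2) (tetrad M a 2)) (tetrad M a 1) x = 0 ∧
      gdot M a (nab M a (tetrad M a 3) (tetrad M a 3)) (tetrad M a 1) x = 0 ∧
      gdot M a (nab M a (tetrad M a 2) (tetrad M a 2)) (tetrad M a 0) x = 0 ∧
      gdot M a (nab M a (tetrad M a 3) (tetrad M a 3)) (tetrad M a 0) x = 0 := by
  intro x hx
  obtain ⟨hr, hS, hD, hρ⟩ := kerr_pos M a ha haM x hx
  have hS' := hS.ne'
  have hD' := hD.ne'
  have hρ' := hρ.ne'
  have hc2 : Real.sin (x 2) ^ 2 + Real.cos (x 2) ^ 2 = 1 := Real.sin_sq_add_cos_sq _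
  obtain ⟨p, hp, hp2⟩ : ∃ p : ℝ, 0 < p ∧ p ^ 2 = rho2 a x :=
    ⟨_, Real.sqrt_pos.2 hρ, Real.sq_sqrt hρ.le⟩
  obtain ⟨q, hq, hq2⟩ : ∃ q : ℝ, 0 < q ∧ q ^ 2 = Del M a x :=
    ⟨_, Real.sqrt_pos.2 hD, Real.sq_sqrt hD.le⟩
  have s1 : Real.sqrt (rho2 a x) = p := by rw [← hp2, Real.sqrt_sq hp.le]
  have s2 : Real.sqrt (rho2 a x * Del M a x) = p * q := by
    rw [← hp2, ← hq2, ← mul_pow, Real.sqrt_sq (by positivity)]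
  have s3 : Real.sqrt (Del M a x / rho2 a x) = q / p := by
    rw [← hp2, ← hq2, ← div_pow, Real.sqrt_sq (by positivity)]
  have hI := kerr_inv M a x hS' hD' hρ'
  have hp' := hp.ne'
  have hq' := hq.ne'
  have er : x 1 ^ 2 = p ^ 2 - a ^ 2 * Real.cos (x 2) ^ 2 := by rw [hp2, rho2]; ring
  have eq : q ^ 2 = x 1 ^ 2 - 2 * M * x 1 + a ^ 2 := by rw [hq2, Del]
  have hρs : rho2 a x = x 1 ^ 2 + a ^ 2 - a ^ 2 * Real.sin (x 2) ^ 2 := by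
    rw [rho2, Real.cos_sq']; ring
  have hC : kC M a x ≠ 0 := div_ne_zero hρ' hD'
  refine ⟨?_, ?_, ?_, ?_, ?_, ?_, ?_, ?_⟩
  · simp only [gdot, nab, chr, hI, kerr_eq, Fin.sum_univ_four]
    simp [tetrad, pd_const', pd_kA0, pd_kB0, pd_kE0, pd_kA3, pd_kB3, pd_kE3, s1, s2, s3]
    rw [pd_kA2 _ _ _ hρ', pd_kB2 _ _ _ hρ', pd_kE2 _ _ _ hρ']
    refine (alg _ _ _ _ _ _ (q⁻¹ * p⁻¹) (x 1 ^ 2 + a ^ 2) a _ _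
      (2 * a ^ 2 * Real.cos (x 2) * Real.sin (x 2) * rho2 a x ^ 2 * Del M a x) hρ' (by ring) (by ring) ?_).trans ?_
    · simp only [Sig2, hρs, Real.cos_sq', Del]
      ring
    · rw [← hp2, ← hq2]
      field_simp
  · simp only [gdot, nab, chr, hI, kerr_eq, Fin.sum_univ_four]
    simp [tetrad, pd_const', pd_kA0, pd_kB0, pd_kE0, pd_kA3, pd_kB3, pd_kE3, s1, s2, s3]
    rw [pd_kA1 _ _ _ hρ', pd_kB1 _ _ _ hρ', pd_kE1 _ _ _ hρ']
    refine (alg _ _ _ _ _ _ (q⁻¹ * p⁻¹) (x 1 ^ 2 + a ^ 2) a _ _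
      (-2 * (a ^ 2 * Real.cos (x 2) ^ 2 * (x 1 - M) + x 1 * (M * x 1 - a ^ 2)) * rho2 a x ^ 2) hC (by ring) (by ring) ?_).trans ?_
    · simp only [Sig2, hρs, Real.cos_sq', Del]
      ring
    · rw [← hp2]
      field_simp
  · simp only [gdot, nab, chr, hI, kerr_eq, Fin.sum_univ_four]
    simp [tetrad, pd_const', pd_kA0, pd_kB0, pd_kE0, pd_kA3, pd_kB3, pd_kE3, s1, s2, s3]
    rw [pd_kA2 _ _ _ hρ', pd_kB2 _ _ _ hρ', pd_kE2 _ _ _ hρ']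
    refine (alg _ _ _ _ _ _ ((Real.sin (x 2))⁻¹ * p⁻¹) (a * Real.sin (x 2) ^ 2) 1 _ _
      (2 * Real.cos (x 2) * (x 1 ^ 2 + a ^ 2) * Real.sin (x 2) * rho2 a x ^ 2) hρ' (by ring) (by ring) ?_).trans ?_
    · simp only [Sig2, hρs, Real.cos_sq', Del]
      ring
    · rw [← hp2]
      field_simp
  · simp only [gdot, nab, chr, hI, kerr_eq, Fin.sum_univ_four]
    simp [tetrad, pd_const', pd_kA0, pd_kB0, pd_kE0, pd_kA3, pd_kB3, pd_kE3, s1, s2, s3]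
    rw [pd_kA1 _ _ _ hρ', pd_kB1 _ _ _ hρ', pd_kE1 _ _ _ hρ']
    refine (alg _ _ _ _ _ _ ((Real.sin (x 2))⁻¹ * p⁻¹) (a * Real.sin (x 2) ^ 2) 1 _ _
      (2 * x 1 * Real.sin (x 2) ^ 2 * rho2 a x ^ 2) hC (by ring) (by ring) ?_).trans ?_
    · simp only [Sig2, hρs, Real.cos_sq', Del]
      ring
    · rw [← hp2]
      field_simp
  all_goals
    simp only [gdot, nab, chr, hI, kerr_eq, Fin.sum_univ_four]
    simp [tetrad, pd_const', pd_kC0, pd_kC3, pd_rho0, pd_rho3]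
end
end

section
/- Let M, a be reals with 0 ≤ a < M, u₀ a real constant, and L : (r₊, ∞) → ℝ a C² function of r. On U, the 2-form F₅ = −(u₀/Δ)(1+L²)^{−1/2} dr ∧ [ (ρ²/sinθ) dθ + L(a dt − (r²+a²) dφ) ] is closed, its current density equals j₅ = −u₀ L′ (1+L²)^{−3/2} (ρ² sin²θ)^{−1} (a sin²θ ∂_t + ∂_φ + L sinθ ∂_θ) where L′ = dL/dr, and F₅ is force-free: F₅_{μν} j₅^ν = 0 on U for all μ. -/
noncomputable section

/-- `wedge μ ν f` is the antisymmetric matrix of the 2-form `f dx^μ ∧ dx^ν`. -/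
def wedge (μ ν : Fin 4) (f : ℝ) : Matrix (Fin 4) (Fin 4) ℝ :=
  Matrix.of fun i j => if i = μ ∧ j = ν then f else if i = ν ∧ j = μ then -f else 0

/-- A 2-form `F` is closed on `S`: ∂_μ F_{νλ} + ∂_ν F_{λμ} + ∂_λ F_{μν} = 0. -/
def Closed2Form (F : (Fin 4 → ℝ) → Matrix (Fin 4) (Fin 4) ℝ) (S : Set (Fin 4 → ℝ)) : Prop :=
  ∀ x ∈ S, ∀ μ ν lam : Fin 4,
    pd μ (fun y => F y ν lam) x + pd ν (fun y => F y lam μ) x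
      + pd lam (fun y => F y μ ν) x = 0

/-- Current density j^μ = (ρ²sinθ)⁻¹ ∂_ν (ρ²sinθ g^{μα} g^{νβ} F_{αβ}). -/
def current (M a : ℝ) (F : (Fin 4 → ℝ) → Matrix (Fin 4) (Fin 4) ℝ)
    (x : Fin 4 → ℝ) (μ : Fin 4) : ℝ :=
  (rho2 a x * Real.sin (x 2))⁻¹ *
    ∑ ν : Fin 4, pd ν (fun y => rho2 a y * Real.sin (y 2) *
      ∑ i : Fin 4, ∑ j : Fin 4, (kerr M a y)⁻¹ μ i * (kerr M a y)⁻¹ ν j * F y i j) x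

/-- `F` is force-free on `S`: F_{μν} j^ν = 0 for the current density `j` of `F`. -/
def ForceFree (M a : ℝ) (F : (Fin 4 → ℝ) → Matrix (Fin 4) (Fin 4) ℝ)
    (S : Set (Fin 4 → ℝ)) : Prop :=
  ∀ x ∈ S, ∀ μ : Fin 4, ∑ ν : Fin 4, F x μ ν * current M a F x ν = 0

/-- F₅ = −(u₀/Δ)(1+L²)^{−1/2} dr ∧ [ (ρ²/sinθ) dθ + L(a dt − (r²+a²) dφ) ]. -/
def F5 (M a u₀ : ℝ) (L : ℝ → ℝ) (x : Fin 4 → ℝ) : Matrix (Fin 4) (Fin 4) ℝ :=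
  wedge 1 2 (-(u₀ / Del M a x) * (Real.sqrt (1 + L (x 1) ^ 2))⁻¹ *
      (rho2 a x / Real.sin (x 2)))
    + wedge 1 0 (-(u₀ / Del M a x) * (Real.sqrt (1 + L (x 1) ^ 2))⁻¹ * (L (x 1) * a))
    + wedge 1 3 (-(u₀ / Del M a x) * (Real.sqrt (1 + L (x 1) ^ 2))⁻¹ *
      (L (x 1) * (-((x 1) ^ 2 + a ^ 2))))

/-- j₅ = −u₀ L′ (1+L²)^{−3/2} (ρ² sin²θ)^{−1} (a sin²θ ∂_t + ∂_φ + L sinθ ∂_θ). -/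
def j5 (a u₀ : ℝ) (L : ℝ → ℝ) (x : Fin 4 → ℝ) : Fin 4 → ℝ := fun μ =>
  -u₀ * deriv L (x 1) * ((Real.sqrt (1 + L (x 1) ^ 2)) ^ 3)⁻¹ *
    (rho2 a x * Real.sin (x 2) ^ 2)⁻¹ *
    ![a * Real.sin (x 2) ^ 2, 0, L (x 1) * Real.sin (x 2), 1] μ

/-- The explicit inverse of the Kerr metric. -/
def kerrInv (M a : ℝ) (x : Fin 4 → ℝ) : Matrix (Fin 4) (Fin 4) ℝ :=
  !![-Sig2 M a x / (rho2 a x * Del M a x), 0, 0, -(2 * M * x 1 * a) / (rho2 a x * Del M a x);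
     0, Del M a x / rho2 a x, 0, 0;
     0, 0, (rho2 a x)⁻¹, 0;
     -(2 * M * x 1 * a) / (rho2 a x * Del M a x), 0, 0,
      (Del M a x - a ^ 2 * Real.sin (x 2) ^ 2) /
        (rho2 a x * Del M a x * Real.sin (x 2) ^ 2)]

/-- Positivity facts on the exterior region. -/
lemma ext_pos {M a : ℝ} (ha : 0 ≤ a) (haM : a < M) {x : Fin 4 → ℝ} (hx : x ∈ KerrExt M a) :
    0 < rho2 a x ∧ 0 < Del M a x ∧ 0 < Real.sin (x 2) := by
  obtain ⟨h1, h2, h3⟩ := hx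
  have hs := Real.sqrt_nonneg (M ^ 2 - a ^ 2)
  have hq : Real.sqrt (M ^ 2 - a ^ 2) ^ 2 = M ^ 2 - a ^ 2 := Real.sq_sqrt (by nlinarith)
  have hr : 0 < x 1 := by linarith
  refine ⟨by unfold rho2; positivity, by unfold Del; nlinarith, Real.sin_pos_of_pos_of_lt_pi h2 h3⟩

lemma kerr_inv_s8 {M a : ℝ} (ha : 0 ≤ a) (haM : a < M) {x : Fin 4 → ℝ} (hx : x ∈ KerrExt M a) :
    (kerr M a x)⁻¹ = kerrInv M a x := by
  obtain ⟨h1, h2, h3⟩ := ext_pos ha haM hx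
  apply Matrix.inv_eq_right_inv
  have hD : Del M a x = (x 1) ^ 2 - 2 * M * (x 1) + a ^ 2 := rfl
  have hR : rho2 a x = (x 1) ^ 2 + a ^ 2 * (1 - Real.sin (x 2) ^ 2) := by
    rw [rho2, Real.cos_sq']
  have h1' := h1.ne'
  have h2' := h2.ne'
  have h3' := h3.ne'
  have hM : 2 * M * x 1 = (x 1) ^ 2 + a ^ 2 - Del M a x := by rw [hD]; ring
  ext i j
  fin_cases i <;> fin_cases j <;>
    simp [kerr, kerrInv, Matrix.mul_apply, Fin.sum_univ_four] <;>
    (try rw [hM]) <;> (try unfold Sig2) <;> field_simp <;>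
    generalize Del M a x = D at * <;> (try rw [hR]) <;> ring

/-- The densitized contravariant form of `F5`. -/
def G5 (a u₀ : ℝ) (L : ℝ → ℝ) (x : Fin 4 → ℝ) : Matrix (Fin 4) (Fin 4) ℝ :=
  wedge 1 2 (-u₀ * (Real.sqrt (1 + L (x 1) ^ 2))⁻¹)
    + wedge 1 0 (u₀ * a * Real.sin (x 2) * (L (x 1) * (Real.sqrt (1 + L (x 1) ^ 2))⁻¹))
    + wedge 1 3 (u₀ / Real.sin (x 2) * (L (x 1) * (Real.sqrt (1 + L (x 1) ^ 2))⁻¹))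

lemma raise_F5 {M a : ℝ} (ha : 0 ≤ a) (haM : a < M) (u₀ : ℝ) (L : ℝ → ℝ)
    {x : Fin 4 → ℝ} (hx : x ∈ KerrExt M a) (μ ν : Fin 4) :
    rho2 a x * Real.sin (x 2) * ∑ i : Fin 4, ∑ j : Fin 4,
      (kerr M a x)⁻¹ μ i * (kerr M a x)⁻¹ ν j * F5 M a u₀ L x i j = G5 a u₀ L x μ ν := by
  rw [kerr_inv_s8 ha haM hx]
  obtain ⟨h1, h2, h3⟩ := ext_pos ha haM hx
  have hD : Del M a x = (x 1) ^ 2 - 2 * M * (x 1) + a ^ 2 := rfl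
  have hR : rho2 a x = (x 1) ^ 2 + a ^ 2 * (1 - Real.sin (x 2) ^ 2) := by
    rw [rho2, Real.cos_sq']
  have h1' := h1.ne'
  have h2' := h2.ne'
  have h3' := h3.ne'
  have hM : 2 * M * x 1 = (x 1) ^ 2 + a ^ 2 - Del M a x := by rw [hD]; ring
  have hs : Real.sqrt (1 + L (x 1) ^ 2) ≠ 0 := (Real.sqrt_pos.2 (by positivity)).ne'
  generalize Real.sqrt (1 + L (x 1) ^ 2) = s at *
  fin_cases μ <;> fin_cases ν <;>
    simp [F5, G5, wedge, kerrInv, Fin.sum_univ_four] <;>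
    (try rw [hM]) <;> (try unfold Sig2) <;> field_simp <;>
    generalize Del M a x = D at * <;> (try rw [hR]) <;> ring

lemma pd_zero_of_indep (μ : Fin 4) (f : (Fin 4 → ℝ) → ℝ) (x : Fin 4 → ℝ)
    (h : ∀ t : ℝ, f (x + t • Pi.single μ (1 : ℝ)) = f x) : pd μ f x = 0 := by
  unfold pd
  by_cases hf : DifferentiableAt ℝ f x
  · rw [← hf.lineDeriv_eq_fderiv]
    unfold lineDeriv
    simp [h]
  · simp [fderiv_zero_of_not_differentiableAt hf]

lemma pd_neg (μ : Fin 4) (f : (Fin 4 → ℝ) → ℝ) (x : Fin 4 → ℝ) :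
    pd μ (fun y => -f y) x = -pd μ f x := by
  simp [pd]

lemma pd_zero (μ : Fin 4) (x : Fin 4 → ℝ) : pd μ (fun _ => (0 : ℝ)) x = 0 := by
  simp [pd]

/-- Radial derivative of a function of separated form. -/
lemma pd_one_sep (k h : ℝ → ℝ) (h' : ℝ) (x : Fin 4 → ℝ) (hk : DifferentiableAt ℝ k (x 2))
    (hh : HasDerivAt h h' (x 1)) : pd 1 (fun y => k (y 2) * h (y 1)) x = k (x 2) * h' := by
  have e1 : HasFDerivAt (fun y : Fin 4 → ℝ => h (y 1)) _ x :=
    hh.comp_hasFDerivAt x (hasFDerivAt_apply (𝕜 := ℝ) (1 : Fin 4) x)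
  have e2 : HasFDerivAt (fun y : Fin 4 → ℝ => k (y 2)) _ x :=
    hk.hasDerivAt.comp_hasFDerivAt x (hasFDerivAt_apply (𝕜 := ℝ) (2 : Fin 4) x)
  unfold pd
  rw [(e2.fun_mul e1).fderiv]
  simp

lemma F5_closed (M a u₀ : ℝ) (L : ℝ → ℝ) (S : Set (Fin 4 → ℝ)) :
    Closed2Form (F5 M a u₀ L) S := by
  intro x _ μ ν lam
  have hz0 : ∀ i j, pd 0 (fun y => F5 M a u₀ L y i j) x = 0 := fun i j =>
    pd_zero_of_indep _ _ _ fun t => by simp [F5, Del, rho2]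
  have hz3 : ∀ i j, pd 3 (fun y => F5 M a u₀ L y i j) x = 0 := fun i j =>
    pd_zero_of_indep _ _ _ fun t => by simp [F5, Del, rho2]
  have h10 : pd 2 (fun y => F5 M a u₀ L y 1 0) x = 0 :=
    pd_zero_of_indep _ _ _ fun t => by simp [F5, Del, wedge]
  have h13 : pd 2 (fun y => F5 M a u₀ L y 1 3) x = 0 :=
    pd_zero_of_indep _ _ _ fun t => by simp [F5, Del, wedge]
  have anti : ∀ i j, pd 1 (fun y => F5 M a u₀ L y i j) x
      = -pd 1 (fun y => F5 M a u₀ L y j i) x := fun i j => by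
    rw [← pd_neg]; congr 1; funext y
    fin_cases i <;> fin_cases j <;> simp [F5, wedge]
  have anti2 : ∀ i j, pd 2 (fun y => F5 M a u₀ L y i j) x
      = -pd 2 (fun y => F5 M a u₀ L y j i) x := fun i j => by
    rw [← pd_neg]; congr 1; funext y
    fin_cases i <;> fin_cases j <;> simp [F5, wedge]
  have h01 := anti2 0 1
  have h31 := anti2 3 1
  rw [h10, neg_zero] at h01
  rw [h13, neg_zero] at h31
  have z : ∀ μ i j, i ≠ 1 → j ≠ 1 → pd μ (fun y => F5 M a u₀ L y i j) x = 0 :=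
    fun μ i j hi hj => by
      rw [← pd_zero μ x]; congr 1; funext y; simp [F5, wedge, hi, hj]
  have z11 : ∀ μ, pd μ (fun y => F5 M a u₀ L y 1 1) x = 0 := fun μ => by
    rw [← pd_zero μ x]; congr 1; funext y; simp [F5, wedge]
  have a12 := anti 1 2
  have a10 := anti 1 0
  have a13 := anti 1 3
  have b12 := anti2 1 2
  fin_cases μ <;> fin_cases ν <;> fin_cases lam <;>
    simp [hz0, hz3, h10, h13, h01, h31, z, z11, a12, a10, a13, b12]

lemma isOpen_ext (M a : ℝ) : IsOpen (KerrExt M a) := by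
  unfold KerrExt
  refine (isOpen_lt continuous_const (continuous_apply _)).inter
    ((isOpen_lt continuous_const (continuous_apply _)).inter
      (isOpen_lt (continuous_apply _) continuous_const))

lemma current_F5 {M a : ℝ} (ha : 0 ≤ a) (haM : a < M) (u₀ : ℝ) (L : ℝ → ℝ)
    (hL : ContDiffOn ℝ 2 L (Set.Ioi (M + Real.sqrt (M ^ 2 - a ^ 2))))
    {x : Fin 4 → ℝ} (hx : x ∈ KerrExt M a) (μ : Fin 4) :
    current M a (F5 M a u₀ L) x μ = j5 a u₀ L x μ := by
  have key : ∀ ν, pd ν (fun y => rho2 a y * Real.sin (y 2) * ∑ i : Fin 4, ∑ j : Fin 4,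
      (kerr M a y)⁻¹ μ i * (kerr M a y)⁻¹ ν j * F5 M a u₀ L y i j) x
      = pd ν (fun y => G5 a u₀ L y μ ν) x := by
    intro ν
    unfold pd
    congr 1
    apply Filter.EventuallyEq.fderiv_eq
    filter_upwards [(isOpen_ext M a).mem_nhds hx] with y hy
    exact raise_F5 ha haM u₀ L hy μ ν
  unfold current
  simp_rw [key]
  obtain ⟨h1, h2, h3⟩ := ext_pos ha haM hx
  have hLd : HasDerivAt L (deriv L (x 1)) (x 1) :=
    ((hL.differentiableOn (by norm_num)).differentiableAt (Ioi_mem_nhds hx.1)).hasDerivAt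
  have hp : 0 < 1 + L (x 1) ^ 2 := by positivity
  have hs : Real.sqrt (1 + L (x 1) ^ 2) ≠ 0 := (Real.sqrt_pos.2 hp).ne'
  have hsq : Real.sqrt (1 + L (x 1) ^ 2) ^ 2 = 1 + L (x 1) ^ 2 := Real.sq_sqrt hp.le
  have d1 : HasDerivAt (fun r => (Real.sqrt (1 + L r ^ 2))⁻¹)
      (-(L (x 1) * deriv L (x 1) / Real.sqrt (1 + L (x 1) ^ 2) ^ 3)) (x 1) := by
    refine ((((hLd.pow 2).const_add 1).sqrt hp.ne').inv hs).congr_deriv ?_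
    simp
    field_simp
  have d2 : HasDerivAt (fun r => L r * (Real.sqrt (1 + L r ^ 2))⁻¹)
      (deriv L (x 1) / Real.sqrt (1 + L (x 1) ^ 2) ^ 3) (x 1) := by
    refine (hLd.mul d1).congr_deriv ?_
    field_simp
    rw [hsq]; ring
  have hz0 : ∀ i j, pd 0 (fun y => G5 a u₀ L y i j) x = 0 := fun i j =>
    pd_zero_of_indep _ _ _ fun t => by simp [G5]
  have hz3 : ∀ i j, pd 3 (fun y => G5 a u₀ L y i j) x = 0 := fun i j =>
    pd_zero_of_indep _ _ _ fun t => by simp [G5]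
  have hz2 : pd 2 (fun y => G5 a u₀ L y μ 2) x = 0 :=
    pd_zero_of_indep _ _ _ fun t => by simp [G5, wedge]
  have e0 : pd 1 (fun y => G5 a u₀ L y 0 1) x = -(u₀ * a * Real.sin (x 2)) *
      (deriv L (x 1) / Real.sqrt (1 + L (x 1) ^ 2) ^ 3) := by
    rw [← pd_one_sep (fun θ => -(u₀ * a * Real.sin θ)) _ _ x (by fun_prop) d2]
    congr 1; funext y; simp [G5, wedge]
  have e1 : pd 1 (fun y => G5 a u₀ L y 1 1) x = 0 := by
    rw [← pd_zero 1 x]; congr 1; funext y; simp [G5, wedge]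
  have e2 : pd 1 (fun y => G5 a u₀ L y 2 1) x = u₀ *
      (-(L (x 1) * deriv L (x 1) / Real.sqrt (1 + L (x 1) ^ 2) ^ 3)) := by
    rw [← pd_one_sep (fun _ => u₀) _ _ x (by fun_prop) d1]
    congr 1; funext y; simp [G5, wedge]
  have e3 : pd 1 (fun y => G5 a u₀ L y 3 1) x = -(u₀ / Real.sin (x 2)) *
      (deriv L (x 1) / Real.sqrt (1 + L (x 1) ^ 2) ^ 3) := by
    rw [← pd_one_sep (fun θ => -(u₀ / Real.sin θ)) _ _ x
      ((DifferentiableAt.div (by fun_prop) (by fun_prop) h3.ne').neg) d2]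
    congr 1; funext y; simp [G5, wedge]
  rw [Fin.sum_univ_four, hz0, hz2, hz3]
  have h1' := h1.ne'
  have h3' := h3.ne'
  fin_cases μ <;> simp [e0, e1, e2, e3, j5] <;> field_simp

lemma force_F5 {M a : ℝ} (ha : 0 ≤ a) (haM : a < M) (u₀ : ℝ) (L : ℝ → ℝ)
    {x : Fin 4 → ℝ} (hx : x ∈ KerrExt M a) (μ : Fin 4) :
    ∑ ν : Fin 4, F5 M a u₀ L x μ ν * j5 a u₀ L x ν = 0 := by
  obtain ⟨h1, h2, h3⟩ := ext_pos ha haM hx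
  have hR : x 1 ^ 2 = rho2 a x - a ^ 2 * (1 - Real.sin (x 2) ^ 2) := by
    rw [rho2, Real.cos_sq']; ring
  have h3' := h3.ne'
  fin_cases μ <;> simp [Fin.sum_univ_four, F5, wedge, j5]
  rw [hR]
  field_simp
  ring

/-- F₅ is closed, its current density is j₅, and F₅ is force-free. -/
theorem kerr_F5_forcefree (M a u₀ : ℝ) (ha : 0 ≤ a) (haM : a < M) (L : ℝ → ℝ)
    (hL : ContDiffOn ℝ 2 L (Set.Ioi (M + Real.sqrt (M ^ 2 - a ^ 2)))) :
    Closed2Form (F5 M a u₀ L) (KerrExt M a) ∧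
    (∀ x ∈ KerrExt M a, ∀ μ : Fin 4,
      current M a (F5 M a u₀ L) x μ = j5 a u₀ L x μ) ∧
    ForceFree M a (F5 M a u₀ L) (KerrExt M a) := by
  refine ⟨F5_closed M a u₀ L _, fun x hx μ => current_F5 ha haM u₀ L hL hx μ, ?_⟩
  intro x hx μ
  simp_rw [current_F5 ha haM u₀ L hL hx]
  exact force_F5 ha haM u₀ L hx μ
end
end
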